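/- Let T be a completely regular Hausdorff space. The following are equivalent: (i) Spec C(T) is a PC-space; (ii) qcop(Spec C(T)) is a Stone algebra; (iii) (Spec C(T))^min is patch closed and T is an F-space (i.e. Spec C(T) is stranded); (iv) T is basically disconnected; (v) the poset C(T) with the pointwise order is Dedekind σ-complete; (vi) for every f ∈ C(T) with f > 0, the interval [0, f] = {g ∈ C(T) : 0 ≤ g ≤ f}, a bounded distributive lattice under pointwise minimum and maximum, is pseudocomplemented. -/

import Mathlib

open Set Topology

namespace PCF

variable {X : Type*}

/-- The compact open subsets of a topological space. -/
def qcop (t : TopologicalSpace X) : Set (Set X) :=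
  {U | @IsOpen X t U ∧ @IsCompact X t U}

/-- The complements of the compact open subsets. -/
def qccl (t : TopologicalSpace X) : Set (Set X) :=
  {C | ∃ U ∈ qcop t, C = Uᶜ}

/-- The Boolean algebra of subsets generated by the compact open sets:
the constructible sets. -/
def Constructible (t : TopologicalSpace X) : Set (Set X) :=
  ⋂₀ {B : Set (Set X) | qcop t ⊆ B ∧ (∀ s ∈ B, sᶜ ∈ B) ∧
        (∀ s ∈ B, ∀ u ∈ B, s ∪ u ∈ B) ∧ (∅ : Set X) ∈ B}

/-- The patch topology: generated by the compact open sets together with their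
complements (equivalently, by the constructible sets). -/
def patchTop (t : TopologicalSpace X) : TopologicalSpace X :=
  TopologicalSpace.generateFrom (qcop t ∪ qccl t)

/-- The inverse topology, with the complements of compact opens as a basis of opens. -/
def invTop (t : TopologicalSpace X) : TopologicalSpace X :=
  TopologicalSpace.generateFrom (qccl t)

/-- The specialization order: `x ≤ y` iff `y` is in the closure of `{x}`. -/
def specLE (t : TopologicalSpace X) (x y : X) : Prop := y ∈ @closure X t {x}

/-- Minimal points for the specialization order. -/
def minPts (t : TopologicalSpace X) : Set X := {x | ∀ y, specLE t y x → y = x}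

/-- Maximal points for the specialization order. -/
def maxPts (t : TopologicalSpace X) : Set X := {x | ∀ y, specLE t x y → y = x}

/-- Minimal points of a subset `S`, for the induced specialization order. -/
def minPtsIn (t : TopologicalSpace X) (S : Set X) : Set X :=
  {x | x ∈ S ∧ ∀ y ∈ S, specLE t y x → y = x}

/-- Maximal points of a subset `S`, for the induced specialization order. -/
def maxPtsIn (t : TopologicalSpace X) (S : Set X) : Set X :=
  {x | x ∈ S ∧ ∀ y ∈ S, specLE t x y → y = x}

/-- The down-set (set of generalizations) generated by `S`. -/
def downset (t : TopologicalSpace X) (S : Set X) : Set X :=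
  {x | ∃ s ∈ S, specLE t x s}

/-- The up-set (set of specializations) generated by `S`. -/
def upset (t : TopologicalSpace X) (S : Set X) : Set X :=
  {x | ∃ s ∈ S, specLE t s x}

/-- A topology is spectral if the space is compact, sober (quasi-sober and T0),
the compact opens form a basis, and the compact opens are closed under
finite intersections. -/
def IsSpectral (t : TopologicalSpace X) : Prop :=
  @CompactSpace X t ∧ @QuasiSober X t ∧ @T0Space X t ∧
  @TopologicalSpace.IsTopologicalBasis X t (qcop t) ∧
  ∀ U ∈ qcop t, ∀ V ∈ qcop t, U ∩ V ∈ qcop t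

/-- A Boolean space: compact, Hausdorff and zero-dimensional. -/
def IsBooleanSpace (t : TopologicalSpace X) : Prop :=
  @CompactSpace X t ∧ @T2Space X t ∧
  @TopologicalSpace.IsTopologicalBasis X t {U | @IsClopen X t U}

/-- `V` is the pseudocomplement of `U` in the lattice of sets `L` (ordered by
inclusion, with meet given by intersection and bottom element `∅`): `V` is the
largest element of `L` disjoint from `U`. -/
def IsPseudoCompl (L : Set (Set X)) (U V : Set X) : Prop :=
  V ∈ L ∧ U ∩ V = ∅ ∧ ∀ W ∈ L, U ∩ W = ∅ → W ⊆ V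

/-- The lattice of sets `L` is pseudocomplemented: every element has a
pseudocomplement. -/
def Pseudocomplemented (L : Set (Set X)) : Prop :=
  ∀ U ∈ L, ∃ V, IsPseudoCompl L U V

/-- The lattice of sets `L` is a Stone algebra: it is pseudocomplemented and
`U* ∪ U** = ⊤` for every `U`. -/
def StoneAlgebra (L : Set (Set X)) : Prop :=
  Pseudocomplemented L ∧
  ∀ U ∈ L, ∀ V W : Set X, IsPseudoCompl L U V → IsPseudoCompl L V W → V ∪ W = univ

/-- The lattice of sets `L` is a Heyting algebra: for all `U, V ∈ L` there is a
largest `W ∈ L` with `U ∩ W ⊆ V`. -/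
def HeytingAlg (L : Set (Set X)) : Prop :=
  ∀ U ∈ L, ∀ V ∈ L, ∃ W ∈ L, U ∩ W ⊆ V ∧ ∀ W' ∈ L, U ∩ W' ⊆ V → W' ⊆ W

/-- A PC-space: the lattice of compact open sets is pseudocomplemented. -/
def IsPCSpace (t : TopologicalSpace X) : Prop := Pseudocomplemented (qcop t)

/-- An Esakia space: the closure of every constructible set is constructible. -/
def IsEsakia (t : TopologicalSpace X) : Prop :=
  ∀ S ∈ Constructible t, @closure X t S ∈ Constructible t

/-- A spectral root system: the closure of every point is a specialization chain. -/
def IsRootSystem (t : TopologicalSpace X) : Prop :=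
  ∀ x : X, IsChain (specLE t) (@closure X t {x})

/-- A spectral forest: the inverse space is a spectral root system. -/
def IsForest (t : TopologicalSpace X) : Prop := IsRootSystem (invTop t)

/-- A stranded space: the specialization poset is a disjoint union of chains, i.e.
the set of points comparable with any fixed point is a chain. -/
def Stranded (t : TopologicalSpace X) : Prop :=
  ∀ x : X, IsChain (specLE t) {y | specLE t x y ∨ specLE t y x}

end PCF

open PCF

section Rings

variable (T : Type*) [TopologicalSpace T]

/-- The zero set of a continuous real-valued function. -/
def zeroSet (f : ContinuousMap T ℝ) : Set T := {t | f t = 0}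

/-- The lattice of cozero sets of a topological space. -/
def Coz : Set (Set T) := {U | ∃ f : ContinuousMap T ℝ, U = {t | f t ≠ 0}}

/-- A z-ideal of the ring `C(T)` of continuous real-valued functions. -/
def IsZIdeal (I : Ideal (ContinuousMap T ℝ)) : Prop :=
  ∀ f ∈ I, ∀ g : ContinuousMap T ℝ, zeroSet T f ⊆ zeroSet T g → g ∈ I

/-- The prime z-ideals, as a subset of the prime spectrum of `C(T)`. -/
def zSpec : Set (PrimeSpectrum (ContinuousMap T ℝ)) :=
  {p | IsZIdeal T p.asIdeal}

/-- A space is basically disconnected if the closure of every cozero set is open. -/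
def BasicallyDisconnected : Prop :=
  ∀ f : ContinuousMap T ℝ, IsOpen (closure {t | f t ≠ 0})

/-- The Zariski topology on the prime spectrum of `C(T)`. -/
def specTop : TopologicalSpace (PrimeSpectrum (ContinuousMap T ℝ)) := inferInstance

/-- The subspace topology on the set of prime z-ideals. -/
def zTop : TopologicalSpace ↥(zSpec T) := inferInstance

end Rings

/-- The subspace topology on a subset. -/
def subTop {Y : Type*} [TopologicalSpace Y] (X : Set Y) : TopologicalSpace ↥X :=
  inferInstance

section FunctionRing

variable {T : Type*} [TopologicalSpace T]

theorem dvd_sq_of_abs_le {f g : C(T, ℝ)} (h : ∀ t, |g t| ≤ |f t|) : f ∣ g ^ 2 := by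
  have hle : ∀ t, |g t ^ 2 / f t| ≤ |f t| := by
    intro t
    by_cases hf : f t = 0
    · simp [hf]
    · rw [abs_div, abs_pow, div_le_iff₀ (abs_pos.mpr hf), ← sq]
      exact pow_le_pow_left₀ (abs_nonneg _) (h t) 2
  have hc : Continuous fun t => g t ^ 2 / f t := by
    rw [continuous_iff_continuousAt]
    intro t
    by_cases hf : f t = 0
    · have h0 : Filter.Tendsto (fun s => |f s|) (𝓝 t) (𝓝 0) := by
        have := (continuous_abs.comp f.continuous).tendsto t
        simpa [hf, Function.comp_def] using this
      have := squeeze_zero_norm (f := fun s => g s ^ 2 / f s) hle h0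
      simpa [ContinuousAt, hf] using this
    · exact ((g.continuous.pow 2).continuousAt).div f.continuous.continuousAt hf
  refine ⟨⟨_, hc⟩, ?_⟩
  ext t
  by_cases hf : f t = 0
  · have := h t
    simp_all
  · simp [mul_div_cancel₀ _ hf]

/-- Prime ideals of `C(T)` are absolutely convex. -/
theorem mem_of_abs_le (p : Ideal C(T, ℝ)) [hp : p.IsPrime] {f g : C(T, ℝ)} (hf : f ∈ p)
    (h : ∀ t, |g t| ≤ |f t|) : g ∈ p :=
  hp.mem_of_pow_mem 2 (p.mem_of_dvd (dvd_sq_of_abs_le h) hf)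

theorem exists_indicator {U : Set T} (hU : IsClopen U) :
    ∃ e : C(T, ℝ), (∀ t ∈ U, e t = 1) ∧ ∀ t ∉ U, e t = 0 := by
  have hc : Continuous (U.indicator fun _ => (1 : ℝ)) :=
    continuous_const.indicator (by simp [hU.frontier_eq])
  exact ⟨⟨_, hc⟩, fun t ht => indicator_of_mem (f := fun _ => (1 : ℝ)) ht,
    fun t ht => indicator_of_notMem (f := fun _ => (1 : ℝ)) ht⟩

theorem BasicallyDisconnected.exists_idempotent (hT : BasicallyDisconnected T) (f : C(T, ℝ)) :
    ∃ e : C(T, ℝ), (∀ t, e t = 0 ∨ e t = 1) ∧ f * e = f ∧ ∀ g, f * g = 0 → e * g = 0 := by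
  obtain ⟨e, h1, h0⟩ := exists_indicator ⟨isClosed_closure, hT f⟩
  refine ⟨e, fun t => ?_, ?_, fun g hg => ?_⟩
  · by_cases ht : t ∈ closure {t | f t ≠ 0}
    exacts [.inr (h1 t ht), .inl (h0 t ht)]
  · ext t
    by_cases ht : f t = 0
    · simp [ht]
    · simp [h1 t (subset_closure ht)]
  · ext t
    by_cases ht : t ∈ closure {t | f t ≠ 0}
    · have hsub : closure {t | f t ≠ 0} ⊆ {t | g t = 0} := by
        refine closure_minimal (fun s hs => ?_) (isClosed_eq g.continuous continuous_const)
        have := DFunLike.congr_fun hg s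
        simpa [show f s ≠ 0 from hs] using this
      have : g t = 0 := hsub ht
      simp [this]
    · simp [h0 t ht]

theorem exists_eq_one_of_notMem [CompletelyRegularSpace T] {K : Set T} (hK : IsClosed K) {t : T}
    (ht : t ∉ K) :
    ∃ k : C(T, ℝ), 0 ≤ k ∧ k ≤ 1 ∧ k t = 1 ∧ ∀ s ∈ K, k s = 0 := by
  obtain ⟨f, hf, hft, hfK⟩ := CompletelyRegularSpace.completely_regular t K hK ht
  refine ⟨⟨fun s => 1 - (f s : ℝ), by fun_prop⟩, fun s => ?_, fun s => ?_, ?_, fun s hs => ?_⟩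
  · simpa using (f s).2.2
  · simpa using (f s).2.1
  · simp [hft]
  · simp [hfK hs]

theorem basicallyDisconnected_of_exists [CompletelyRegularSpace T]
    (h : ∀ f : C(T, ℝ), ∃ e : C(T, ℝ), (∀ t, f t ≠ 0 → e t = 1) ∧
      ∀ k : C(T, ℝ), 0 ≤ k → k ≤ 1 → f * k = 0 → ∀ t, k t = 1 → e t = 0) :
    BasicallyDisconnected T := by
  intro f
  obtain ⟨e, h1, h0⟩ := h f
  have heq : closure {t | f t ≠ 0} = {t | e t ≠ 0} := by
    refine Subset.antisymm (fun t ht => ?_) fun t ht => ?_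
    · have : closure {t | f t ≠ 0} ⊆ {t | e t = 1} :=
        closure_minimal h1 (isClosed_eq e.continuous continuous_const)
      have : e t = 1 := this ht
      simp [this]
    · by_contra hcl
      obtain ⟨k, hk0, hk1, hkt, hk⟩ := exists_eq_one_of_notMem isClosed_closure hcl
      refine ht (h0 k hk0 hk1 ?_ t hkt)
      ext s
      by_cases hs : f s = 0
      · simp [hs]
      · simp [hk s (subset_closure hs)]
  rw [heq]
  exact isOpen_ne_fun e.continuous continuous_const

/-- Cozero sets are closed under countable unions. -/
theorem exists_ne_zero_iff_exists (h : ℕ → C(T, ℝ)) :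
    ∃ H : C(T, ℝ), ∀ t, H t ≠ 0 ↔ ∃ n, h n t ≠ 0 := by
  have hs : Summable fun n : ℕ => ((1 : ℝ) / 2) ^ n := summable_geometric_two
  have hb : ∀ n t, ‖((1 : ℝ) / 2) ^ n * min |h n t| 1‖ ≤ (1 / 2) ^ n := by
    intro n t
    rw [Real.norm_of_nonneg (by positivity)]
    exact mul_le_of_le_one_right (by positivity) (min_le_right _ _)
  refine ⟨⟨fun t => ∑' n, ((1 : ℝ) / 2) ^ n * min |h n t| 1,
    continuous_tsum (fun n => by fun_prop) hs hb⟩, fun t => ?_⟩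
  have hsum : Summable fun n => ((1 : ℝ) / 2) ^ n * min |h n t| 1 :=
    .of_norm_bounded hs fun n => hb n t
  have hz := hasSum_zero_iff_of_nonneg (L := .unconditional ℕ)
    (f := fun n => ((1 : ℝ) / 2) ^ n * min |h n t| 1)
    fun n => by positivity
  rw [← not_iff_not, not_exists]
  simp only [ContinuousMap.coe_mk, not_not]
  rw [← hsum.hasSum_iff, hz, funext_iff]
  refine forall_congr' fun n => ?_
  have hpow : ((1 : ℝ) / 2) ^ n ≠ 0 := by positivity
  simp only [Pi.zero_apply, mul_eq_zero, hpow, false_or]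
  constructor
  · intro hn
    by_contra hne
    have : 0 < min |h n t| 1 := lt_min (abs_pos.mpr hne) one_pos
    exact this.ne' hn
  · intro hn
    simp [hn]

/-- A function decaying at the zero set of `g` slower than every root of `g`. -/
theorem exists_forall_pow_dvd_isClosed (g : C(T, ℝ)) :
    ∃ φ : C(T, ℝ), (∀ t, g t = 0 → φ t = 0) ∧ ∀ n : ℕ, g ∣ φ ^ n → IsClosed {t | g t ≠ 0} := by
  set a : ℕ → T → ℝ := fun n t => (min |g t| 1) ^ (1 / ((n : ℝ) + 1)) with ha
  have ha0 : ∀ n t, 0 ≤ a n t := fun n t => by positivity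
  have ha1 : ∀ n t, a n t ≤ 1 := fun n t =>
    Real.rpow_le_one (by positivity) (min_le_right _ _) (by positivity)
  have hac : ∀ n, Continuous (a n) := fun n =>
    Continuous.rpow_const (by fun_prop) fun t => .inr (by positivity)
  have hpow : ∀ n t, a n t ^ (n + 1) = min |g t| 1 := fun n t => by
    rw [ha, ← Real.rpow_natCast, ← Real.rpow_mul (by positivity)]
    push_cast
    rw [one_div_mul_cancel (by positivity), Real.rpow_one]
  have haz : ∀ n t, g t = 0 → a n t = 0 := fun n t ht => by
    have := hpow n t
    rw [ht] at this
    simpa using this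
  have hs : Summable fun n : ℕ => ((1 : ℝ) / 2) ^ n := summable_geometric_two
  have hb : ∀ n t, ‖((1 : ℝ) / 2) ^ n * a n t‖ ≤ (1 / 2) ^ n := by
    intro n t
    rw [Real.norm_of_nonneg (mul_nonneg (by positivity) (ha0 n t))]
    exact mul_le_of_le_one_right (by positivity) (ha1 n t)
  refine ⟨⟨fun t => ∑' n, ((1 : ℝ) / 2) ^ n * a n t,
    continuous_tsum (fun n => continuous_const.mul (hac n)) hs hb⟩, fun t ht => ?_, ?_⟩
  · simp [haz _ t ht]
  rintro n ⟨k, hk⟩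
  have hbound : {t | g t ≠ 0} ⊆
      {t | ((1 / 2 : ℝ) ^ n) ^ n ≤ a n t * (max |g t| 1 * |k t|)} := by
    intro t ht
    have hsum : Summable fun m => ((1 : ℝ) / 2) ^ m * a m t :=
      .of_norm_bounded hs fun m => hb m t
    have hle : (1 / 2 : ℝ) ^ n * a n t ≤ ∑' m, ((1 : ℝ) / 2) ^ m * a m t :=
      hsum.le_tsum n fun m _ => mul_nonneg (by positivity) (ha0 m t)
    have hkt : (∑' m, ((1 : ℝ) / 2) ^ m * a m t) ^ n = g t * k t := by
      simpa using DFunLike.congr_fun hk t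
    have hpos : 0 < a n t := by
      refine (ha0 n t).lt_of_ne' fun h0 => ?_
      have := hpow n t
      rw [h0, zero_pow n.succ_ne_zero] at this
      have : 0 < min |g t| 1 := lt_min (abs_pos.mpr ht) one_pos
      linarith
    have hmm : |g t| = a n t ^ (n + 1) * max |g t| 1 := by rw [hpow, min_mul_max, mul_one]
    have hchain : ((1 / 2 : ℝ) ^ n) ^ n * a n t ^ n ≤
        (a n t * (max |g t| 1 * |k t|)) * a n t ^ n := by
      calc ((1 / 2 : ℝ) ^ n) ^ n * a n t ^ n = ((1 / 2 : ℝ) ^ n * a n t) ^ n := by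
            rw [mul_pow]
        _ ≤ g t * k t := hkt ▸ pow_le_pow_left₀ (mul_nonneg (by positivity) (ha0 n t)) hle n
        _ ≤ |g t| * |k t| := by rw [← abs_mul]; exact le_abs_self _
        _ = (a n t * (max |g t| 1 * |k t|)) * a n t ^ n := by
            linear_combination |k t| * hmm
    exact le_of_mul_le_mul_right hchain (pow_pos hpos n)
  have hcl : closure {t | g t ≠ 0} ⊆
      {t | ((1 / 2 : ℝ) ^ n) ^ n ≤ a n t * (max |g t| 1 * |k t|)} :=
    closure_minimal hbound (isClosed_le continuous_const ((hac n).mul (by fun_prop)))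
  refine isClosed_of_closure_subset fun t ht h0 => ?_
  have hbt : ((1 / 2 : ℝ) ^ n) ^ n ≤ a n t * (max |g t| 1 * |k t|) := hcl ht
  rw [haz n t h0, zero_mul] at hbt
  have : (0 : ℝ) < ((1 / 2 : ℝ) ^ n) ^ n := by positivity
  linarith

end FunctionRing

section SigmaComplete

variable {T : Type*} [TopologicalSpace T]

theorem BasicallyDisconnected.exists_isLUB (hT : BasicallyDisconnected T) {S : Set C(T, ℝ)}
    (hne : S.Nonempty) (hS : S.Countable) (hbdd : BddAbove S) : ∃ f, IsLUB S f := by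
  obtain ⟨b, hb⟩ := hbdd
  obtain ⟨f, rfl⟩ := hS.exists_eq_range hne
  have hfb : ∀ n t, f n t ≤ b t := fun n t => hb (mem_range_self n) t
  set U : ℝ → Set T := fun r => closure {t | ∃ n, r < f n t} with hU
  have hUo : ∀ r, IsOpen (U r) := by
    intro r
    obtain ⟨H, hH⟩ := exists_ne_zero_iff_exists fun n => (f n - ContinuousMap.const T r) ⊔ 0
    have : U r = closure {t | H t ≠ 0} := by
      simp only [hU, hH]
      congr! 4 with t n
      simp
    rw [this]
    exact hT H
  have hUanti : ∀ {r s}, r ≤ s → U s ⊆ U r := fun hrs =>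
    closure_mono fun t ⟨n, hn⟩ => ⟨n, hrs.trans_lt hn⟩
  have hUle : ∀ {r t} (g : C(T, ℝ)), (∀ n, f n ≤ g) → t ∈ U r → r ≤ g t := by
    intro r t g hg ht
    have : U r ⊆ {t | r ≤ g t} := closure_minimal
      (fun s ⟨n, hn⟩ => hn.le.trans (hg n s)) (isClosed_le continuous_const g.continuous)
    exact this ht
  have hUmem : ∀ {r t} n, r < f n t → t ∈ U r := fun n hn => subset_closure ⟨n, hn⟩
  have hbd : ∀ t, BddAbove {r | t ∈ U r} := fun t => ⟨b t, fun r hr => hUle b hfb hr⟩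
  have hnon : ∀ t, {r | t ∈ U r}.Nonempty := fun t => ⟨f 0 t - 1, hUmem 0 (by linarith)⟩
  have hcont : Continuous fun t => sSup {r | t ∈ U r} := by
    rw [continuous_iff_continuousAt]
    intro t
    refine tendsto_order.2 ⟨fun a ha => ?_, fun a ha => ?_⟩
    · obtain ⟨r, hr, har⟩ := exists_lt_of_lt_csSup (hnon t) ha
      filter_upwards [(hUo r).mem_nhds hr] with s hs
      exact har.trans_le (le_csSup (hbd s) hs)
    · obtain ⟨q, hq, hqa⟩ := exists_between ha
      have htq : t ∉ U q := fun h => hq.not_ge (le_csSup (hbd t) h)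
      filter_upwards [isClosed_closure.isOpen_compl.mem_nhds htq] with s hs
      refine (csSup_le (hnon s) fun r hr => ?_).trans_lt hqa
      by_contra! hqr
      exact hs (hUanti hqr.le hr)
  refine ⟨⟨_, hcont⟩, ?_, fun g hg t => ?_⟩
  · rintro _ ⟨n, rfl⟩ t
    exact le_of_forall_lt fun r hr => by
      obtain ⟨q, hq, hqn⟩ := exists_between hr
      exact hq.trans_le (le_csSup (hbd t) (hUmem n hqn))
  · exact csSup_le (hnon t) fun r hr => hUle g (fun n => hg (mem_range_self n)) hr

theorem basicallyDisconnected_of_forall_exists_isLUB [CompletelyRegularSpace T]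
    (h : ∀ S : Set C(T, ℝ), S.Nonempty → S.Countable → BddAbove S → ∃ f, IsLUB S f) :
    BasicallyDisconnected T := by
  refine basicallyDisconnected_of_exists fun f => ?_
  set u : ℕ → C(T, ℝ) := fun n => (n • |f|) ⊓ 1 with hu
  have hu1 : ∀ n, u n ≤ 1 := fun n => inf_le_right
  have hut : ∀ n t, u n t = min (n * |f t|) 1 := fun n t => by simp [hu]
  obtain ⟨e, he⟩ := h (range u) (range_nonempty u) (countable_range u)
    ⟨1, forall_mem_range.2 hu1⟩
  have he0 : 0 ≤ e := fun t => by
    simpa [hut] using he.1 (mem_range_self 0) t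
  refine ⟨e, fun t ht => le_antisymm (he.2 (forall_mem_range.2 hu1) t) ?_,
    fun k hk0 hk1 hfk t hkt => le_antisymm ?_ (he0 t)⟩
  · obtain ⟨n, hn⟩ := Archimedean.arch 1 (abs_pos.mpr ht)
    have : u n t ≤ e t := he.1 (mem_range_self n) t
    rw [hut, min_eq_right (by simpa using hn)] at this
    exact this
  · have hub : 1 - k ∈ upperBounds (range u) := by
      rintro _ ⟨n, rfl⟩ s
      change u n s ≤ 1 - k s
      rw [hut]
      by_cases hs : f s = 0
      · simpa [hs] using hk1 s
      · have hks : k s = 0 := by simpa [hs] using DFunLike.congr_fun hfk s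
        simp [hks]
    simpa [hkt] using he.2 hub t

end SigmaComplete

section Intervals

variable {T : Type*} [TopologicalSpace T]

theorem BasicallyDisconnected.exists_pseudocompl_Icc (hT : BasicallyDisconnected T)
    {f : C(T, ℝ)} (hf : 0 ≤ f) (g : C(T, ℝ)) (hg : 0 ≤ g) :
    ∃ h : C(T, ℝ), 0 ≤ h ∧ h ≤ f ∧ (∀ x, min (g x) (h x) = 0) ∧
      ∀ k : C(T, ℝ), 0 ≤ k → k ≤ f → (∀ x, min (g x) (k x) = 0) → k ≤ h := by
  obtain ⟨e, he, hge, hmax⟩ := hT.exists_idempotent g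
  have hf' : ∀ t, 0 ≤ f t := hf
  have hg' : ∀ t, 0 ≤ g t := hg
  refine ⟨f * (1 - e), fun t => ?_, fun t => ?_, fun t => ?_, fun k hk0 hkf hk t => ?_⟩
  · rcases he t with h | h <;> simp [h, hf' t]
  · rcases he t with h | h <;> simp [h, hf' t]
  · rcases he t with h | h
    · have : g t = 0 := by simpa [h, eq_comm] using DFunLike.congr_fun hge t
      simp [this, h, hf' t]
    · simp [h, hg' t]
  · have hgk : g * k = 0 := by
      ext t
      change g t * k t = 0
      rw [← min_mul_max, hk, zero_mul]
    have hek := DFunLike.congr_fun (hmax k hgk) t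
    rcases he t with h | h
    · simpa [h] using hkf t
    · have : k t = 0 := by simpa [h] using hek
      simp [this, h]

theorem basicallyDisconnected_of_exists_pseudocompl_Icc [CompletelyRegularSpace T]
    (H : ∀ f : C(T, ℝ), 0 < f → ∀ g : C(T, ℝ), 0 ≤ g → g ≤ f →
      ∃ h : C(T, ℝ), 0 ≤ h ∧ h ≤ f ∧ (∀ x, min (g x) (h x) = 0) ∧
        ∀ k : C(T, ℝ), 0 ≤ k → k ≤ f → (∀ x, min (g x) (k x) = 0) → k ≤ h) :
    BasicallyDisconnected T := by
  cases isEmpty_or_nonempty T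
  · exact fun f => by simp [Set.eq_empty_of_isEmpty]
  refine basicallyDisconnected_of_exists fun f => ?_
  obtain ⟨h, hh0, hh1, hgh, hmax⟩ := H 1 zero_lt_one (|f| ⊓ 1)
    (le_inf (abs_nonneg f) zero_le_one) inf_le_right
  refine ⟨1 - h, fun t ht => ?_, fun k hk0 hk1 hfk t hkt => ?_⟩
  · have hpos : 0 < min |f t| 1 := lt_min (abs_pos.mpr ht) one_pos
    have hmin : min (min |f t| 1) (h t) = 0 := by simpa using hgh t
    have : h t = 0 := by
      rcases min_choice (min |f t| 1) (h t) with h' | h'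
      · exact absurd (h'.symm.trans hmin) hpos.ne'
      · exact h'.symm.trans hmin
    simp [this]
  · have hkh : k ≤ h := hmax k hk0 hk1 fun s => by
      have hs0 : 0 ≤ k s := hk0 s
      by_cases hs : f s = 0
      · simp [hs, hs0]
      · have : k s = 0 := by simpa [hs] using DFunLike.congr_fun hfk s
        simp [this]
    have h1 : k t ≤ h t := hkh t
    have h2 : h t ≤ 1 := hh1 t
    have : h t = 1 := by linarith
    simp [this]

end Intervals

section Spectrum

theorem patchTop_eq_constructibleTopology {X : Type*} [t : TopologicalSpace X] :
    patchTop t = constructibleTopology X := by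
  have : qcop t ∪ qccl t = constructibleTopologySubbasis X := by
    ext s
    refine or_congr Iff.rfl ⟨?_, fun h => ⟨sᶜ, ⟨h.1.isOpen_compl, h.2⟩, (compl_compl s).symm⟩⟩
    rintro ⟨U, hU, rfl⟩
    exact ⟨hU.1.isClosed_compl, by simpa using hU.2⟩
  rw [patchTop, constructibleTopology, this]

theorem compactSpace_patchTop {X : Type*} [t : TopologicalSpace X] [SpectralSpace X] :
    @CompactSpace X (patchTop t) := by
  rw [patchTop_eq_constructibleTopology]
  have h := isCompact_univ (X := WithConstructibleTopology X)
  have himg := @IsCompact.image _ _ _ (constructibleTopology X) _ _ h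
    (WithTopology.continuous_ofTopology (constructibleTopology X))
  rw [image_univ_of_surjective fun x => ⟨.toTopology _ x, rfl⟩] at himg
  exact @CompactSpace.mk X (constructibleTopology X) himg

/-- A prime ideal containing the annihilator of `f` lies above a prime ideal avoiding `f`. -/
theorem exists_isPrime_le_notMem {A : Type*} [CommRing A] [IsReduced A] (p : Ideal A)
    [hp : p.IsPrime] {f : A} (h : ∀ g, f * g = 0 → g ∈ p) :
    ∃ q : Ideal A, q.IsPrime ∧ q ≤ p ∧ f ∉ q := by
  have hdis : Disjoint ((⊥ : Ideal A) : Set A)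
      (p.primeCompl ⊔ Submonoid.powers f : Submonoid A) := by
    rw [Set.disjoint_left]
    rintro x rfl hx
    obtain ⟨s, hs, _, ⟨n, rfl⟩, hsf⟩ := Submonoid.mem_sup.1 hx
    refine hs (h s (pow_eq_zero_iff (n := n + 1) n.succ_ne_zero |>.1 ?_))
    have hsf' : s * f ^ n = 0 := hsf
    calc (f * s) ^ (n + 1) = (s * f ^ n) * (s ^ n * f) := by ring
      _ = 0 := by rw [hsf', zero_mul]
  obtain ⟨q, hq, -, hqS⟩ := Ideal.exists_le_prime_disjoint _ _ hdis
  rw [Set.disjoint_left] at hqS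
  refine ⟨q, hq, fun x hx => ?_, fun hf => ?_⟩
  · by_contra hxp
    exact hqS hx (SetLike.le_def.1 le_sup_left hxp)
  · exact hqS hf (SetLike.le_def.1 le_sup_right (Submonoid.mem_powers f))

variable {T : Type*} [TopologicalSpace T]

instance : IsReduced C(T, ℝ) :=
  ⟨fun f ⟨n, hn⟩ => ContinuousMap.ext fun t =>
    eq_zero_of_pow_eq_zero (n := n) (by simpa using DFunLike.congr_fun hn t)⟩

theorem specLE_specTop_iff {p q : PrimeSpectrum C(T, ℝ)} :
    specLE (specTop T) p q ↔ p.asIdeal ≤ q.asIdeal :=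
  (PrimeSpectrum.le_iff_mem_closure p q).symm

theorem sq_add_sq_mem_iff (p : Ideal C(T, ℝ)) [hp : p.IsPrime] {f g : C(T, ℝ)} :
    f ^ 2 + g ^ 2 ∈ p ↔ f ∈ p ∧ g ∈ p := by
  refine ⟨fun h => ⟨hp.mem_of_pow_mem 2 (mem_of_abs_le p h fun t => ?_),
    hp.mem_of_pow_mem 2 (mem_of_abs_le p h fun t => ?_)⟩, fun h => ?_⟩
  · exact abs_le_abs_of_nonneg (sq_nonneg (f t)) (le_add_of_nonneg_right (sq_nonneg (g t)))
  · exact abs_le_abs_of_nonneg (sq_nonneg (g t)) (le_add_of_nonneg_left (sq_nonneg (f t)))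
  · exact p.add_mem (p.pow_mem_of_mem h.1 2 two_pos) (p.pow_mem_of_mem h.2 2 two_pos)

theorem exists_mem_iff_forall_mem (s : Finset C(T, ℝ)) :
    ∃ f : C(T, ℝ), ∀ p : PrimeSpectrum C(T, ℝ), f ∈ p.asIdeal ↔ ∀ g ∈ s, g ∈ p.asIdeal := by
  classical
  induction s using Finset.induction_on with
  | empty => exact ⟨0, fun p => by simp⟩
  | insert a s _ ih =>
    obtain ⟨f, hf⟩ := ih
    exact ⟨a ^ 2 + f ^ 2, fun p => by simp [sq_add_sq_mem_iff, hf]⟩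

theorem mem_qcop_specTop_iff {U : Set (PrimeSpectrum C(T, ℝ))} :
    U ∈ qcop (specTop T) ↔ ∃ f : C(T, ℝ), U = {p | f ∉ p.asIdeal} := by
  constructor
  · rintro ⟨ho, hc⟩
    obtain ⟨s, rfl⟩ := PrimeSpectrum.isCompact_isOpen_iff.1 ⟨hc, ho⟩
    obtain ⟨f, hf⟩ := exists_mem_iff_forall_mem s
    refine ⟨f, ?_⟩
    ext p
    simp [hf, PrimeSpectrum.mem_zeroLocus, Set.subset_def]
  · rintro ⟨f, rfl⟩
    exact ⟨(PrimeSpectrum.basicOpen f).isOpen, PrimeSpectrum.isCompact_basicOpen f⟩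

theorem basicOpen_inter_eq_empty_iff {f g : C(T, ℝ)} :
    {p : PrimeSpectrum C(T, ℝ) | f ∉ p.asIdeal} ∩ {p | g ∉ p.asIdeal} = ∅ ↔ f * g = 0 := by
  have hnil : (∀ p : PrimeSpectrum C(T, ℝ), f * g ∈ p.asIdeal) ↔ f * g = 0 := by
    refine ⟨fun h => ?_, fun h p => h ▸ p.asIdeal.zero_mem⟩
    rw [← isNilpotent_iff_eq_zero, nilpotent_iff_mem_prime]
    exact fun J hJ => h ⟨J, hJ⟩
  rw [← hnil, Set.eq_empty_iff_forall_notMem]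
  refine forall_congr' fun p => ?_
  rw [p.2.mul_mem_iff_mem_or_mem]
  simp only [mem_inter_iff, mem_ofPred_eq]
  tauto

theorem isPseudoCompl_basicOpen {f e : C(T, ℝ)} (hfe : f * e = 0)
    (h : ∀ g, f * g = 0 → e * g = g) :
    IsPseudoCompl (qcop (specTop T)) {p | f ∉ p.asIdeal} {p | e ∉ p.asIdeal} := by
  refine ⟨mem_qcop_specTop_iff.2 ⟨e, rfl⟩, basicOpen_inter_eq_empty_iff.2 hfe, fun W hW hfW => ?_⟩
  obtain ⟨g, rfl⟩ := mem_qcop_specTop_iff.1 hW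
  intro p hp he
  exact hp (h g (basicOpen_inter_eq_empty_iff.1 hfW) ▸ p.asIdeal.mul_mem_right g he)

theorem PCF.IsPseudoCompl.eq {X : Type*} {L : Set (Set X)} {U V W : Set X}
    (hV : IsPseudoCompl L U V) (hW : IsPseudoCompl L U W) : V = W :=
  (hW.2.2 V hV.1 hV.2.1).antisymm (hV.2.2 W hW.1 hW.2.1)

theorem BasicallyDisconnected.stoneAlgebra (hT : BasicallyDisconnected T) :
    StoneAlgebra (qcop (specTop T)) := by
  have key : ∀ U ∈ qcop (specTop T), ∃ e : C(T, ℝ), e * e = e ∧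
      IsPseudoCompl (qcop (specTop T)) U {p | e ∉ p.asIdeal} := by
    intro U hU
    obtain ⟨f, rfl⟩ := mem_qcop_specTop_iff.1 hU
    obtain ⟨e, he, hfe, hmax⟩ := hT.exists_idempotent f
    refine ⟨1 - e, ?_, isPseudoCompl_basicOpen (by rw [mul_sub, hfe, mul_one, sub_self])
      fun g hg => by rw [sub_mul, hmax g hg, one_mul, sub_zero]⟩
    ext t
    rcases he t with h | h <;> simp [h]
  refine ⟨fun U hU => (key U hU).imp' (fun e => {p | e ∉ p.asIdeal}) fun e he => he.2,
    fun U hU V W hV hW => ?_⟩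
  obtain ⟨e, he, heU⟩ := key U hU
  obtain rfl := hV.eq heU
  have h1 : IsPseudoCompl (qcop (specTop T)) {p | e ∉ p.asIdeal} {p | 1 - e ∉ p.asIdeal} :=
    isPseudoCompl_basicOpen (by rw [mul_sub, he, mul_one, sub_self])
      fun g hg => by rw [sub_mul, hg, one_mul, sub_zero]
  obtain rfl := hW.eq h1
  refine eq_univ_of_forall fun p => ?_
  by_contra hp
  simp only [mem_union, mem_ofPred_eq, not_or, not_not] at hp
  exact p.2.ne_top ((Ideal.eq_top_iff_one _).2 (by simpa using p.asIdeal.add_mem hp.1 hp.2))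

theorem basicallyDisconnected_of_isPCSpace [CompletelyRegularSpace T]
    (h : IsPCSpace (specTop T)) : BasicallyDisconnected T := by
  intro f
  obtain ⟨V, hV, hfV, hmax⟩ := h _ (mem_qcop_specTop_iff.2 ⟨f, rfl⟩)
  obtain ⟨g, rfl⟩ := mem_qcop_specTop_iff.1 hV
  have hle : ∀ k : C(T, ℝ), f * k = 0 → ∃ n, g ∣ k ^ n := fun k hk => by
    have hsub : PrimeSpectrum.basicOpen k ≤ PrimeSpectrum.basicOpen g :=
      hmax _ (mem_qcop_specTop_iff.2 ⟨k, rfl⟩) (basicOpen_inter_eq_empty_iff.2 hk)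
    obtain ⟨n, hn⟩ := (PrimeSpectrum.basicOpen_le_basicOpen_iff k g).1 hsub
    exact ⟨n, Ideal.mem_span_singleton.1 hn⟩
  have hfg := basicOpen_inter_eq_empty_iff.1 hfV
  have hzero : ∀ t, f t ≠ 0 → g t = 0 := fun t ht => by
    simpa [ht] using DFunLike.congr_fun hfg t
  obtain ⟨φ, hφ, hclosed⟩ := exists_forall_pow_dvd_isClosed g
  obtain ⟨n, hn⟩ := hle φ (by
    ext t
    by_cases ht : f t = 0
    · simp [ht]
    · simp [hφ t (hzero t ht)])
  have heq : closure {t | f t ≠ 0} = {t | g t ≠ 0}ᶜ := by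
    refine Subset.antisymm (closure_minimal (fun t ht => not_not.2 (hzero t ht))
      (isOpen_ne_fun g.continuous continuous_const).isClosed_compl) fun t ht => ?_
    by_contra hcl
    obtain ⟨k, -, -, hkt, hk⟩ := exists_eq_one_of_notMem isClosed_closure hcl
    obtain ⟨m, hm⟩ := hle k (by
      ext s
      by_cases hs : f s = 0
      · simp [hs]
      · simp [hk s (subset_closure hs)])
    obtain ⟨c, hc⟩ := hm
    have hgt : g t = 0 := not_not.1 ht
    simpa [hkt, hgt] using DFunLike.congr_fun hc t
  rw [heq]
  exact (hclosed n hn).isOpen_compl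

theorem BasicallyDisconnected.stranded (hT : BasicallyDisconnected T) :
    Stranded (specTop T) := by
  intro p q₁ h₁ q₂ h₂ _
  simp only [mem_ofPred_eq, specLE_specTop_iff] at h₁ h₂ ⊢
  by_contra! hcon
  obtain ⟨a, ha₁, ha₂⟩ := SetLike.not_le_iff_exists.1 hcon.1
  obtain ⟨b, hb₂, hb₁⟩ := SetLike.not_le_iff_exists.1 hcon.2
  obtain ⟨e, he, hue, hmax⟩ := hT.exists_idempotent ((|a| - |b|) ⊔ 0)
  have hee : e * (1 - e) = 0 := by
    ext t
    rcases he t with h | h <;> simp [h]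
  have hor : ∀ q : PrimeSpectrum C(T, ℝ), e ∈ q.asIdeal ∨ 1 - e ∈ q.asIdeal := fun q =>
    q.2.mem_or_mem (hee ▸ q.asIdeal.zero_mem)
  have hnand : ∀ q : PrimeSpectrum C(T, ℝ), ¬ (e ∈ q.asIdeal ∧ 1 - e ∈ q.asIdeal) := fun q h =>
    q.2.ne_top ((Ideal.eq_top_iff_one _).2 (by simpa using q.asIdeal.add_mem h.1 h.2))
  have hiff : ∀ q : PrimeSpectrum C(T, ℝ), p.asIdeal ≤ q.asIdeal ∨ q.asIdeal ≤ p.asIdeal →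
      (e ∈ p.asIdeal ↔ e ∈ q.asIdeal) := by
    rintro q (hq | hq)
    · exact ⟨fun h => hq h, fun h => (hor p).resolve_right fun h' => hnand q ⟨h, hq h'⟩⟩
    · exact ⟨fun h => (hor q).resolve_right fun h' => hnand p ⟨h, hq h'⟩, fun h => hq h⟩
  have habs : ∀ (q : PrimeSpectrum C(T, ℝ)) {c : C(T, ℝ)}, c ∈ q.asIdeal → |c| ∈ q.asIdeal :=
    fun q c hc => mem_of_abs_le q.asIdeal hc fun t => by simp
  have hmem : ∀ (q : PrimeSpectrum C(T, ℝ)) {c d w : C(T, ℝ)}, d ∈ q.asIdeal → w ∈ q.asIdeal →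
      (∀ t, |c t| - |d t| ≤ w t) → c ∈ q.asIdeal := fun q c d w hd hw hcd =>
    mem_of_abs_le q.asIdeal (q.asIdeal.add_mem (habs q hd) hw) fun t => by
      have : |c t| ≤ |d t| + w t := by linarith [hcd t]
      exact this.trans (le_abs_self _)
  by_cases hep : e ∈ p.asIdeal
  · refine ha₂ (hmem q₂ hb₂ (w := (|a| - |b|) ⊔ 0) ?_ fun t => by simp)
    rw [← hue]
    exact q₂.asIdeal.mul_mem_left _ ((hiff q₂ h₂).1 hep)
  · refine hb₁ (hmem q₁ ha₁ (w := (|b| - |a|) ⊔ 0) ?_ fun t => by simp)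
    have h0 : e * ((|b| - |a|) ⊔ 0) = 0 := hmax _ <| by
      ext t
      rcases le_total |a t| |b t| with h | h <;> simp [h]
    have : (1 - e) * ((|b| - |a|) ⊔ 0) = (|b| - |a|) ⊔ 0 := by
      rw [sub_mul, h0, one_mul, sub_zero]
    rw [← this]
    exact q₁.asIdeal.mul_mem_right _ ((hor q₁).resolve_left fun h => hep ((hiff q₁ h₁).2 h))

theorem isOpen_patchTop_basicOpen (f : C(T, ℝ)) :
    IsOpen[patchTop (specTop T)] {p : PrimeSpectrum C(T, ℝ) | f ∉ p.asIdeal} :=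
  TopologicalSpace.isOpen_generateFrom_of_mem (.inl (mem_qcop_specTop_iff.2 ⟨f, rfl⟩))

theorem isClosed_patchTop_basicOpen (f : C(T, ℝ)) :
    IsClosed[patchTop (specTop T)] {p : PrimeSpectrum C(T, ℝ) | f ∉ p.asIdeal} :=
  @IsClosed.mk _ (patchTop (specTop T)) _ <| TopologicalSpace.isOpen_generateFrom_of_mem
    (.inr ⟨_, mem_qcop_specTop_iff.2 ⟨f, rfl⟩, rfl⟩)

theorem exists_mul_eq_zero_of_mem_minPts {p : PrimeSpectrum C(T, ℝ)}
    (hp : p ∈ minPts (specTop T)) {f : C(T, ℝ)} (hf : f ∈ p.asIdeal) :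
    ∃ g, f * g = 0 ∧ g ∉ p.asIdeal := by
  by_contra! h
  obtain ⟨q, hq, hqp, hfq⟩ := exists_isPrime_le_notMem p.asIdeal h
  have : (⟨q, hq⟩ : PrimeSpectrum C(T, ℝ)) = p := hp _ (specLE_specTop_iff.2 hqp)
  subst this
  exact hfq hf

theorem BasicallyDisconnected.isClosed_minPts (hT : BasicallyDisconnected T) :
    IsClosed[patchTop (specTop T)] (minPts (specTop T)) := by
  choose e he hfe hmax using hT.exists_idempotent
  have heq : minPts (specTop T) = ⋂ f, ({p | f ∉ p.asIdeal} ∪ {p | 1 - e f ∉ p.asIdeal}) := by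
    ext p
    simp only [mem_iInter, mem_union, mem_ofPred_eq]
    refine ⟨fun hp f => ?_, fun h q hqp => ?_⟩
    · by_contra! hf
      obtain ⟨g, hfg, hg⟩ := exists_mul_eq_zero_of_mem_minPts hp hf.1
      have : (1 - e f) * g = g := by rw [sub_mul, hmax f g hfg, one_mul, sub_zero]
      exact hg (this ▸ p.asIdeal.mul_mem_right g hf.2)
    · rw [specLE_specTop_iff] at hqp
      refine PrimeSpectrum.ext (hqp.antisymm fun f hf => ?_)
      have h0 : f * (1 - e f) = 0 := by rw [mul_sub, hfe, mul_one, sub_self]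
      exact (q.2.mem_or_mem (h0 ▸ q.asIdeal.zero_mem)).resolve_right fun h' =>
        (h f).elim (fun h => h hf) fun h => h (hqp h')
  rw [heq]
  exact @isClosed_iInter _ _ (patchTop (specTop T)) _ fun f =>
    @IsClosed.union _ _ _ (patchTop (specTop T)) (isClosed_patchTop_basicOpen f)
      (isClosed_patchTop_basicOpen _)

theorem exists_mul_eq_zero_and_forall_minPts
    (hmin : IsClosed[patchTop (specTop T)] (minPts (specTop T))) (f : C(T, ℝ)) :
    ∃ g, f * g = 0 ∧ ∀ p ∈ minPts (specTop T), f ∈ p.asIdeal → g ∉ p.asIdeal := by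
  have hcomp : @CompactSpace _ (patchTop (specTop T)) :=
    compactSpace_patchTop (t := PrimeSpectrum.zariskiTopology)
  have hZ : @IsCompact _ (patchTop (specTop T))
      (minPts (specTop T) ∩ {p | f ∉ p.asIdeal}ᶜ) :=
    @IsClosed.isCompact _ (patchTop (specTop T)) _ hcomp
      (@IsClosed.inter _ _ _ (patchTop (specTop T)) hmin
        ((@isClosed_compl_iff _ (patchTop (specTop T)) _).2 (isOpen_patchTop_basicOpen f)))
  obtain ⟨⟨g, hg⟩, hsub⟩ := @IsCompact.elim_directed_cover _ (patchTop (specTop T)) _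
    {g : C(T, ℝ) // f * g = 0} ⟨⟨0, mul_zero f⟩⟩ hZ (fun g => {p | g.1 ∉ p.asIdeal})
    (fun g => isOpen_patchTop_basicOpen g.1)
    (fun p hp => by
      obtain ⟨g, hfg, hg⟩ := exists_mul_eq_zero_of_mem_minPts hp.1 (not_not.1 hp.2)
      exact mem_iUnion.2 ⟨⟨g, hfg⟩, hg⟩)
    (fun g h => ⟨⟨g.1 ^ 2 + h.1 ^ 2, by
        linear_combination g.1 * g.2 + h.1 * h.2⟩,
      fun p hp h' => hp ((sq_add_sq_mem_iff p.asIdeal).1 h').1,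
      fun p hp h' => hp ((sq_add_sq_mem_iff p.asIdeal).1 h').2⟩)
  exact ⟨g, hg, fun p hp hf => hsub ⟨hp, not_not.2 hf⟩⟩

theorem exists_mem_minPts_notMem {k : C(T, ℝ)} (hk : k ≠ 0) :
    ∃ p ∈ minPts (specTop T), k ∉ p.asIdeal := by
  obtain ⟨J, hJ, hkJ⟩ : ∃ J : Ideal C(T, ℝ), J.IsPrime ∧ k ∉ J := by
    rw [Ne, ← isNilpotent_iff_eq_zero, nilpotent_iff_mem_prime] at hk
    simpa using hk
  obtain ⟨p, hp, hpJ⟩ := Ideal.exists_minimalPrimes_le (I := ⊥) (bot_le (a := J))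
  refine ⟨⟨p, hp.1.1⟩, fun q hq => ?_, fun h => hkJ (hpJ h)⟩
  rw [specLE_specTop_iff] at hq
  exact PrimeSpectrum.ext (hq.antisymm (hp.2 ⟨q.2, bot_le⟩ hq))

theorem basicallyDisconnected_of_isClosed_minPts [CompletelyRegularSpace T]
    (hmin : IsClosed[patchTop (specTop T)] (minPts (specTop T)))
    (hstr : Stranded (specTop T)) : BasicallyDisconnected T := by
  refine basicallyDisconnected_of_exists fun f => ?_
  obtain ⟨g, hfg, hg⟩ := exists_mul_eq_zero_and_forall_minPts hmin f
  have hreg : ∀ k, f * k = 0 → g * k = 0 → k = 0 := by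
    intro k hfk hgk
    by_contra hk
    obtain ⟨p, hp, hkp⟩ := exists_mem_minPts_notMem hk
    have hf : f ∈ p.asIdeal := (p.2.mem_or_mem (hfk ▸ p.asIdeal.zero_mem)).resolve_right hkp
    exact hg p hp hf ((p.2.mem_or_mem (hgk ▸ p.asIdeal.zero_mem)).resolve_right hkp)
  have htop : (Ideal.span {f}).annihilator ⊔ (Ideal.span {g}).annihilator = ⊤ := by
    by_contra hne
    obtain ⟨m, hm, hle⟩ := Ideal.exists_le_maximal _ hne
    have hm' := hm.isPrime
    obtain ⟨q₁, hq₁, hq₁m, hf₁⟩ := exists_isPrime_le_notMem m (f := f) fun k hk =>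
      hle (SetLike.le_def.1 le_sup_left (Submodule.mem_annihilator_span_singleton _ _ |>.2
        (by rwa [smul_eq_mul, mul_comm])))
    obtain ⟨q₂, hq₂, hq₂m, hg₂⟩ := exists_isPrime_le_notMem m (f := g) fun k hk =>
      hle (SetLike.le_def.1 le_sup_right (Submodule.mem_annihilator_span_singleton _ _ |>.2
        (by rwa [smul_eq_mul, mul_comm])))
    have hg₁ : g ∈ q₁ := (hq₁.mem_or_mem (hfg ▸ q₁.zero_mem)).resolve_left hf₁
    have hf₂ : f ∈ q₂ := (hq₂.mem_or_mem (hfg ▸ q₂.zero_mem)).resolve_right hg₂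
    have hne : (⟨q₁, hq₁⟩ : PrimeSpectrum C(T, ℝ)) ≠ ⟨q₂, hq₂⟩ := by
      rw [Ne, PrimeSpectrum.mk.injEq]
      rintro rfl
      exact hf₁ hf₂
    rcases hstr ⟨m, hm'⟩ (.inr (specLE_specTop_iff.2 hq₁m)) (.inr (specLE_specTop_iff.2 hq₂m))
      hne with h | h
    · exact hg₂ (specLE_specTop_iff.1 h hg₁)
    · exact hf₁ (specLE_specTop_iff.1 h hf₂)
  obtain ⟨a, ha, b, hb, hab⟩ := Submodule.mem_sup.1 ((Ideal.eq_top_iff_one _).1 htop)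
  rw [Submodule.mem_annihilator_span_singleton, smul_eq_mul] at ha hb
  have hfb : f * b = f := by linear_combination f * hab - ha
  refine ⟨b, fun t ht => ?_, fun k _ _ hfk t hkt => ?_⟩
  · simpa [ht] using DFunLike.congr_fun hfb t
  · have hbk : b * k = 0 := hreg _ (by linear_combination b * hfk) (by linear_combination k * hb)
    simpa [hkt] using DFunLike.congr_fun hbk t

end Spectrum

/-- For a completely regular Hausdorff space `T`, TFAE:
(i) `Spec C(T)` is a PC-space; (ii) `qcop (Spec C(T))` is a Stone algebra;
(iii) `(Spec C(T))^min` is patch closed and `T` is an F-space (i.e. `Spec C(T)` is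
stranded); (iv) `T` is basically disconnected; (v) the poset `C(T)` is Dedekind
σ-complete; (vi) for every `f > 0` in `C(T)`, the interval `[0, f]` with pointwise
min/max is pseudocomplemented. -/
theorem statement_14 {T : Type*} [TopologicalSpace T] [CompletelyRegularSpace T]
    [T2Space T] :
    List.TFAE
      [ IsPCSpace (specTop T),
        StoneAlgebra (qcop (specTop T)),
        IsClosed[patchTop (specTop T)] (minPts (specTop T)) ∧ Stranded (specTop T),
        BasicallyDisconnected T,
        ∀ S : Set (ContinuousMap T ℝ), S.Nonempty → S.Countable → BddAbove S →
          ∃ f, IsLUB S f,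
        ∀ f : ContinuousMap T ℝ, 0 < f →
          ∀ g : ContinuousMap T ℝ, 0 ≤ g → g ≤ f →
            ∃ h : ContinuousMap T ℝ, 0 ≤ h ∧ h ≤ f ∧ (∀ x, min (g x) (h x) = 0) ∧
              ∀ k : ContinuousMap T ℝ, 0 ≤ k → k ≤ f →
                (∀ x, min (g x) (k x) = 0) → k ≤ h ] := by
  tfae_have 1 → 4 := basicallyDisconnected_of_isPCSpace
  tfae_have 4 → 2 := fun h => h.stoneAlgebra
  tfae_have 2 → 1 := fun h => h.1
  tfae_have 4 → 3 := fun h => ⟨h.isClosed_minPts, h.stranded⟩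
  tfae_have 3 → 4 := fun h => basicallyDisconnected_of_isClosed_minPts h.1 h.2
  tfae_have 4 → 5 := fun h _ hne hS hbdd => h.exists_isLUB hne hS hbdd
  tfae_have 5 → 4 := basicallyDisconnected_of_forall_exists_isLUB
  tfae_have 4 → 6 := fun h _ hf g hg _ => h.exists_pseudocompl_Icc hf.le g hg
  tfae_have 6 → 4 := basicallyDisconnected_of_exists_pseudocompl_Icc
  tfae_finish
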